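/- arXiv:1411.4410 — 10 statements merged into one kernel-verified Lean document; each statement's English description precedes it below -/
import Mathlib

section
/- Let R be a reduced commutative ring. If fracpairs satisfy (p, q) =cc (r, s), then q = 0 if and only if s = 0. In particular, if R is nontrivial (0 ≠ 1) and r ≠ 0, then (p, 0) is not cc-equivalent to (q, r). -/
/-- One step of the common cancellation relation CC:
`(x*z, y*(z*z))` is related to `(x, y*z)`. -/
def CC {R : Type*} [CommRing R] (a b : R × R) : Prop :=
  ∃ x y z : R, a = (x * z, y * (z * z)) ∧ b = (x, y * z)

/-- cc-equivalence: the smallest equivalence relation containing all instances of CC. -/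
def ccEq {R : Type*} [CommRing R] (a b : R × R) : Prop :=
  Relation.EqvGen CC a b

theorem ccEq.snd_eq_zero_iff {R : Type*} [CommRing R] (hred : ∀ x : R, x * x = 0 → x = 0)
    {a b : R × R} (h : ccEq a b) : a.2 = 0 ↔ b.2 = 0 := by
  induction h with
  | rel a b h =>
    obtain ⟨x, y, z, rfl, rfl⟩ := h
    change y * (z * z) = 0 ↔ y * z = 0
    constructor
    · intro h
      exact hred _ (by linear_combination y * h)
    · intro h
      linear_combination z * h
  | refl a => exact Iff.rfl
  | symm a b _ ih => exact ih.symm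
  | trans a b c _ _ ih₁ ih₂ => exact ih₁.trans ih₂

theorem stmt1 {R : Type*} [CommRing R] (hred : ∀ x : R, x * x = 0 → x = 0) :
    (∀ p q r s : R, ccEq (p, q) (r, s) → (q = 0 ↔ s = 0)) ∧
    ((0 : R) ≠ 1 → ∀ p q r : R, r ≠ 0 → ¬ ccEq (p, (0 : R)) (q, r)) := by
  have key : ∀ p q r s : R, ccEq (p, q) (r, s) → (q = 0 ↔ s = 0) :=
    fun _ _ _ _ h => h.snd_eq_zero_iff hred
  exact ⟨key, fun _ p q r hr h => hr ((key p 0 q r h).1 rfl)⟩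
end

section
/- Let R be a reduced commutative ring and p, q, r, s ∈ R. If (p, q) =cc (r, s) and q is a non-zerodivisor of R, then s is a non-zerodivisor of R and p·s = q·r holds in R. -/
/-- A common cancellation step preserves and reflects non-zerodivisor denominators, and relates
fracpairs with equal cross products. -/
theorem CC.denom_iff_and_cross {R : Type*} [CommRing R] {a b : R × R} (h : CC a b) :
    ((∀ w : R, a.2 * w = 0 → w = 0) ↔ (∀ w : R, b.2 * w = 0 → w = 0)) ∧
      a.1 * b.2 = a.2 * b.1 := by
  obtain ⟨x, y, z, rfl, rfl⟩ := h
  refine ⟨⟨fun h w hw => h w ?_, fun h w hw => h w ?_⟩, by ring⟩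
  · linear_combination z * hw
  · have hzw : z * w = 0 := h (z * w) (by linear_combination hw)
    linear_combination y * hzw

/-- Fracpairs that are cc-equivalent have non-zerodivisor denominators simultaneously, and in that
case their cross products agree. -/
theorem ccEq.denom_iff_and_cross {R : Type*} [CommRing R] {a b : R × R} (h : ccEq a b) :
    ((∀ w : R, a.2 * w = 0 → w = 0) ↔ (∀ w : R, b.2 * w = 0 → w = 0)) ∧
      ((∀ w : R, a.2 * w = 0 → w = 0) → a.1 * b.2 = a.2 * b.1) := by
  induction h with
  | rel a b h => exact ⟨h.denom_iff_and_cross.1, fun _ => h.denom_iff_and_cross.2⟩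
  | refl a => exact ⟨Iff.rfl, fun _ => mul_comm _ _⟩
  | symm a b _ ih =>
    exact ⟨ih.1.symm, fun hb => by linear_combination -ih.2 (ih.1.2 hb)⟩
  | trans a b c _ _ ihab ihbc =>
    refine ⟨ihab.1.trans ihbc.1, fun ha => ?_⟩
    have hb := ihab.1.1 ha
    refine sub_eq_zero.1 (hb _ ?_)
    linear_combination c.2 * ihab.2 ha + a.2 * ihbc.2 hb

theorem stmt3 {R : Type*} [CommRing R] (hred : ∀ x : R, x * x = 0 → x = 0)
    (p q r s : R) (h : ccEq (p, q) (r, s))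
    (hq : ∀ y : R, q * y = 0 → y = 0) :
    (∀ y : R, s * y = 0 → y = 0) ∧ p * s = q * r := by
  have hcc := h.denom_iff_and_cross
  exact ⟨hcc.1.1 hq, hcc.2 hq⟩
end

section
/- Let R be a nontrivial (0 ≠ 1) reduced commutative ring and p, q ∈ R. (i) If (p, 1) =cc (q, 1), then p = q in R. (ii) If p and q are non-zerodivisors of R and (1, p) =cc (1, q), then p = q in R. -/
/-- Modulo a prime ideal, cc-equivalent fracpairs have simultaneously vanishing denominators, and
agree as fractions when their denominators do not vanish. -/
lemma ccEq.mod_prime {R : Type*} [CommRing R] {a b : R × R} (h : ccEq a b)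
    (P : Ideal R) (hP : P.IsPrime) :
    (a.2 ∈ P ↔ b.2 ∈ P) ∧ (a.2 ∉ P → a.1 * b.2 - b.1 * a.2 ∈ P) := by
  induction h with
  | rel a b h =>
    obtain ⟨x, y, z, rfl, rfl⟩ := h
    refine ⟨?_, fun _ => ?_⟩
    · simp only [hP.mul_mem_iff_mem_or_mem]
      tauto
    · have : x * z * (y * z) - x * (y * (z * z)) = 0 := by ring
      simp [this]
  | refl a => exact ⟨Iff.rfl, fun _ => by simp⟩
  | symm a b _ ih =>
    refine ⟨ih.1.symm, fun hb => ?_⟩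
    rw [← neg_sub]
    exact P.neg_mem (ih.2 (mt ih.1.1 hb))
  | trans a b c _ _ ih₁ ih₂ =>
    refine ⟨ih₁.1.trans ih₂.1, fun ha => ?_⟩
    have hb : b.2 ∉ P := mt ih₁.1.2 ha
    refine (hP.mem_or_mem ?_).resolve_left hb
    have key : b.2 * (a.1 * c.2 - c.1 * a.2) =
        c.2 * (a.1 * b.2 - b.1 * a.2) + a.2 * (b.1 * c.2 - c.1 * b.2) := by ring
    rw [key]
    exact P.add_mem (P.mul_mem_left _ (ih₁.2 ha)) (P.mul_mem_left _ (ih₂.2 hb))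

/-- In a reduced ring, elements congruent modulo every prime ideal are equal. -/
lemma eq_of_forall_prime_sub_mem {R : Type*} [CommRing R] [IsReduced R] {p q : R}
    (h : ∀ P : Ideal R, P.IsPrime → p - q ∈ P) : p = q :=
  sub_eq_zero.1 (nilpotent_iff_mem_prime.2 h).eq_zero

theorem stmt5 {R : Type*} [CommRing R] (hred : ∀ x : R, x * x = 0 → x = 0)
    (hnt : (0 : R) ≠ 1) (p q : R) :
    (ccEq ((p, 1) : R × R) (q, 1) → p = q) ∧
    ((∀ y : R, p * y = 0 → y = 0) → (∀ y : R, q * y = 0 → y = 0) →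
      ccEq ((1, p) : R × R) (1, q) → p = q) := by
  have : IsReduced R := isReduced_iff_pow_one_lt 2 one_lt_two |>.2 fun x hx =>
    hred x (by rwa [← sq])
  refine ⟨fun h => eq_of_forall_prime_sub_mem fun P hP => ?_,
    fun _ _ h => eq_of_forall_prime_sub_mem fun P hP => ?_⟩
  · simpa using (h.mod_prime P hP).2 hP.one_notMem
  · obtain ⟨hiff, hsub⟩ := h.mod_prime P hP
    by_cases hp : p ∈ P
    · exact P.sub_mem hp (hiff.1 hp)
    · rw [← neg_sub, P.neg_mem_iff]
      simpa using hsub hp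
end

section
/- Let R be a reduced commutative ring and let S ⊆ R be a multiplicative subset (1 ∈ S and S is closed under multiplication) that is saturated (x·y ∈ S implies x ∈ S). If (p, q) =cc (r, s) for p, r, s ∈ R and q ∈ S, then s ∈ S and there exists u ∈ S with u·(p·s − q·r) = 0 (i.e., (p, q) and (r, s) become equal in the localization S⁻¹R). -/
/-- A cc-equivalence preserves membership of the denominator in a saturated multiplicative set `S`,
and if the denominators lie in `S` then the fractions agree in the localization at `S`. -/
theorem ccEq.mem_iff_and_exists_mul_eq_zero {R : Type*} [CommRing R] {S : Set R}
    (hone : (1 : R) ∈ S) (hmul : ∀ u v : R, u ∈ S → v ∈ S → u * v ∈ S)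
    (hsat : ∀ x y : R, x * y ∈ S → x ∈ S) {a b : R × R} (h : ccEq a b) :
    (a.2 ∈ S ↔ b.2 ∈ S) ∧ (a.2 ∈ S → ∃ u ∈ S, u * (a.1 * b.2 - a.2 * b.1) = 0) := by
  induction h with
  | rel a b hab =>
    obtain ⟨x, y, z, rfl, rfl⟩ := hab
    refine ⟨⟨fun h => hsat (y * z) z (by rwa [mul_assoc]), fun h => ?_⟩,
      fun _ => ⟨1, hone, by ring⟩⟩
    rw [← mul_assoc]
    exact hmul _ _ h (hsat z y (by rwa [mul_comm]))
  | refl a => exact ⟨Iff.rfl, fun _ => ⟨1, hone, by ring⟩⟩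
  | symm a b _ ih =>
    refine ⟨ih.1.symm, fun hb => ?_⟩
    obtain ⟨u, hu, e⟩ := ih.2 (ih.1.2 hb)
    exact ⟨u, hu, by linear_combination -e⟩
  | trans a b c _ _ ih₁ ih₂ =>
    refine ⟨ih₁.1.trans ih₂.1, fun ha => ?_⟩
    have hb := ih₁.1.1 ha
    obtain ⟨u, hu, e⟩ := ih₁.2 ha
    obtain ⟨v, hv, f⟩ := ih₂.2 hb
    exact ⟨u * v * b.2, hmul _ _ (hmul _ _ hu hv) hb,
      by linear_combination v * c.2 * e + u * a.2 * f⟩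

theorem stmt6 {R : Type*} [CommRing R] (hred : ∀ x : R, x * x = 0 → x = 0)
    (S : Set R) (hone : (1 : R) ∈ S)
    (hmul : ∀ u v : R, u ∈ S → v ∈ S → u * v ∈ S)
    (hsat : ∀ x y : R, x * y ∈ S → x ∈ S)
    (p q r s : R) (h : ccEq (p, q) (r, s)) (hq : q ∈ S) :
    s ∈ S ∧ ∃ u ∈ S, u * (p * s - q * r) = 0 := by
  have key := h.mem_iff_and_exists_mul_eq_zero hone hmul hsat
  exact ⟨key.1.1 hq, key.2 hq⟩
end

section
/- Let R be a reduced commutative ring. cc-equivalence is a congruence on R × R with respect to the fracpair operations: if a =cc a' and b =cc b', then fadd a b =cc fadd a' b', fmul a b =cc fmul a' b', fneg a =cc fneg a', and finv a =cc finv a'. -/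
/-- Addition of fracpairs. -/
def fadd {R : Type*} [CommRing R] (a b : R × R) : R × R :=
  (a.1 * b.2 + b.1 * a.2, a.2 * b.2)

/-- Multiplication of fracpairs. -/
def fmul {R : Type*} [CommRing R] (a b : R × R) : R × R :=
  (a.1 * b.1, a.2 * b.2)

/-- Additive inverse of fracpairs. -/
def fneg {R : Type*} [CommRing R] (a : R × R) : R × R :=
  (-a.1, a.2)

/-- Multiplicative inverse of fracpairs. -/
def finv {R : Type*} [CommRing R] (a : R × R) : R × R :=
  (a.2 * a.2, a.1 * a.2)

theorem ccEq.map {R : Type*} [CommRing R] {f : R × R → R × R}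
    (hf : ∀ x y z : R, ccEq (f (x * z, y * (z * z))) (f (x, y * z)))
    {a b : R × R} (h : ccEq a b) : ccEq (f a) (f b) := by
  induction h with
  | rel _ _ h =>
    obtain ⟨x, y, z, rfl, rfl⟩ := h
    exact hf x y z
  | refl _ => exact .refl _
  | symm _ _ _ ih => exact .symm _ _ ih
  | trans _ _ _ _ _ ih₁ ih₂ => exact .trans _ _ _ ih₁ ih₂

theorem ccEq_of_eq {R : Type*} [CommRing R] {a b : R × R} (x y z : R)
    (h₁ : a.1 = x * z) (h₂ : a.2 = y * (z * z)) (h₃ : b.1 = x) (h₄ : b.2 = y * z) :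
    ccEq a b :=
  .rel _ _ ⟨x, y, z, Prod.ext h₁ h₂, Prod.ext h₃ h₄⟩

theorem fadd_comm {R : Type*} [CommRing R] (a b : R × R) : fadd a b = fadd b a := by
  ext <;> simp only [fadd] <;> ring

theorem fmul_comm {R : Type*} [CommRing R] (a b : R × R) : fmul a b = fmul b a := by
  ext <;> simp only [fmul] <;> ring

theorem ccEq.fadd_right {R : Type*} [CommRing R] {a a' : R × R} (h : ccEq a a') (b : R × R) :
    ccEq (fadd a b) (fadd a' b) := by
  refine h.map (f := fun a => fadd a b) fun x y z =>
    ccEq_of_eq (x * b.2 + b.1 * (y * z)) (y * b.2) z ?_ ?_ ?_ ?_ <;>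
  simp only [fadd] <;> ring

theorem ccEq.fmul_right {R : Type*} [CommRing R] {a a' : R × R} (h : ccEq a a') (b : R × R) :
    ccEq (fmul a b) (fmul a' b) := by
  refine h.map (f := fun a => fmul a b) fun x y z =>
    ccEq_of_eq (x * b.1) (y * b.2) z ?_ ?_ ?_ ?_ <;>
  simp only [fmul] <;> ring

theorem ccEq.fneg {R : Type*} [CommRing R] {a a' : R × R} (h : ccEq a a') :
    ccEq (fneg a) (fneg a') := by
  refine h.map fun x y z => ccEq_of_eq (-x) y z ?_ ?_ ?_ ?_ <;>
  simp only [_root_.fneg] <;> ring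

theorem ccEq.finv {R : Type*} [CommRing R] {a a' : R × R} (h : ccEq a a') :
    ccEq (finv a) (finv a') := by
  refine h.map fun x y z => .trans _ (y ^ 2 * z ^ 3, x * y * z ^ 2) _
    (ccEq_of_eq (y ^ 2 * z ^ 3) (x * y * z) z ?_ ?_ ?_ ?_)
    (ccEq_of_eq (y ^ 2 * z ^ 2) (x * y) z ?_ ?_ ?_ ?_) <;>
  simp only [_root_.finv] <;> ring

theorem stmt7 {R : Type*} [CommRing R] (hred : ∀ x : R, x * x = 0 → x = 0)
    (a a' b b' : R × R) (ha : ccEq a a') (hb : ccEq b b') :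
    ccEq (fadd a b) (fadd a' b') ∧
    ccEq (fmul a b) (fmul a' b') ∧
    ccEq (fneg a) (fneg a') ∧
    ccEq (finv a) (finv a') := by
  refine ⟨.trans _ _ _ (ha.fadd_right b) ?_, .trans _ _ _ (ha.fmul_right b) ?_, ha.fneg, ha.finv⟩
  · rw [fadd_comm a' b, fadd_comm a' b']
    exact hb.fadd_right a'
  · rw [fmul_comm a' b, fmul_comm a' b']
    exact hb.fmul_right a'
end

section
/- Let R be a reduced commutative ring. For every fracpair a over R, finv (finv a) =cc fadd a (fmul (0, 1) (finv a)); that is, the common-meadow axiom (x⁻¹)⁻¹ = x + 0·x⁻¹ holds for fracpairs modulo cc-equivalence. -/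
theorem stmt9 {R : Type*} [CommRing R] (hred : ∀ x : R, x * x = 0 → x = 0)
    (a : R × R) :
    ccEq (finv (finv a)) (fadd a (fmul ((0, 1) : R × R) (finv a))) := by
  refine Relation.EqvGen.rel _ _ ⟨a.1 * a.1 * a.2, a.1 * a.2, a.2, ?_, ?_⟩ <;>
    ext <;> simp only [finv, fadd, fmul] <;> ring
end

section
/- In any common meadow, -(x·y) = x·(-y) for all x, y (and in particular 0·x = 0·(-x)). -/
/-- A common meadow: a commutative monoid for `+` and `·` with a weak additive
inverse, an inverse operation, and an absorbing error element `⊥`, satisfying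
the axioms of Bergstra–Ponse. -/
class CommonMeadow (M : Type*) extends Zero M, One M, Add M, Mul M, Neg M, Inv M where
  bot : M
  add_assoc : ∀ x y z : M, (x + y) + z = x + (y + z)
  add_comm : ∀ x y : M, x + y = y + x
  add_zero : ∀ x : M, x + 0 = x
  add_neg : ∀ x : M, x + (-x) = 0 * x
  neg_neg : ∀ x : M, -(-x) = x
  mul_assoc : ∀ x y z : M, (x * y) * z = x * (y * z)
  mul_comm : ∀ x y : M, x * y = y * x
  one_mul : ∀ x : M, 1 * x = x
  mul_add : ∀ x y z : M, x * (y + z) = x * y + x * z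
  zero_mul_sq : ∀ x : M, 0 * (x * x) = 0 * x
  inv_inv : ∀ x : M, (x⁻¹)⁻¹ = x + 0 * x⁻¹
  mul_inv : ∀ x : M, x * x⁻¹ = 1 + 0 * x⁻¹
  mul_inv_distrib : ∀ x y : M, (x * y)⁻¹ = x⁻¹ * y⁻¹
  one_inv : (1 : M)⁻¹ = 1
  zero_inv : (0 : M)⁻¹ = bot
  add_bot : ∀ x : M, x + bot = bot
  mul_bot : ∀ x : M, x * bot = bot

namespace CommonMeadow

variable {M : Type*} [CommonMeadow M]

theorem zero_mul_neg (x : M) : 0 * (-x) = 0 * x := by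
  rw [← add_neg, neg_neg, add_comm, add_neg]

theorem add_zero_mul (x : M) : x + 0 * x = x := by
  calc x + 0 * x = x * (1 + 0) := by rw [mul_add, mul_comm x 1, one_mul, mul_comm x 0]
    _ = x := by rw [add_zero, mul_comm, one_mul]

theorem zero_mul_mul (x y : M) : 0 * (x * y) = x * (0 * y) := by
  rw [← mul_assoc, mul_comm 0 x, mul_assoc]

theorem neg_mul_eq_mul_neg (x y : M) : -(x * y) = x * (-y) := by
  have h : x * y + x * (-y) = 0 * (x * y) := by
    rw [← mul_add, add_neg, zero_mul_mul]
  have h0 : 0 * (x * (-y)) = 0 * (x * y) := by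
    rw [zero_mul_mul, zero_mul_neg, zero_mul_mul]
  calc -(x * y) = -(x * y) + 0 * (x * y) := by rw [← zero_mul_neg (x * y), add_zero_mul]
    _ = (x * y + -(x * y)) + x * (-y) := by rw [← h, ← add_assoc, add_comm (-(x * y))]
    _ = x * (-y) + 0 * (x * (-y)) := by rw [add_neg, h0, add_comm]
    _ = x * (-y) := add_zero_mul _

end CommonMeadow

theorem stmt14 {M : Type*} [CommonMeadow M] (x y : M) :
    -(x * y) = x * (-y) ∧ 0 * x = 0 * (-x) :=
  ⟨CommonMeadow.neg_mul_eq_mul_neg x y, (CommonMeadow.zero_mul_neg x).symm⟩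
end

section
/- In any common meadow, x·(x⁻¹·x⁻¹) = x⁻¹ for all x; consequently (x·z)·(y·(z·z))⁻¹ = x·(y·z)⁻¹ for all x, y, z. -/
namespace CommonMeadow

variable {M : Type*} [CommonMeadow M]

instance : Std.Associative (α := M) (· * ·) := ⟨mul_assoc⟩

instance : Std.Commutative (α := M) (· * ·) := ⟨mul_comm⟩

theorem mul_inv_mul_inv (x : M) : x * (x⁻¹ * x⁻¹) = x⁻¹ := by
  rw [← mul_assoc, mul_inv, mul_comm, mul_add, mul_comm _ 1, one_mul, mul_comm, mul_assoc,
    zero_mul_sq, add_zero_mul]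

end CommonMeadow

theorem stmt16 {M : Type*} [CommonMeadow M] :
    (∀ x : M, x * (x⁻¹ * x⁻¹) = x⁻¹) ∧
    (∀ x y z : M, (x * z) * (y * (z * z))⁻¹ = x * (y * z)⁻¹) := by
  refine ⟨CommonMeadow.mul_inv_mul_inv, fun x y z => ?_⟩
  simp only [CommonMeadow.mul_inv_distrib]
  calc x * z * (y⁻¹ * (z⁻¹ * z⁻¹)) = x * (y⁻¹ * (z * (z⁻¹ * z⁻¹))) := by ac_rfl
    _ = x * (y⁻¹ * z⁻¹) := by rw [CommonMeadow.mul_inv_mul_inv]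
end

section
/- In any common meadow, the weak additive inverse property x + (-x) + x = x holds for all x, and the weak additive inverse is unique: for given x, if y satisfies x + y + x = x and y + x + y = y, then y = -x. -/
namespace CommonMeadow

variable {M : Type*} [CommonMeadow M]

instance : AddCommSemigroup M where
  add_assoc := CommonMeadow.add_assoc
  add_comm := CommonMeadow.add_comm

theorem zero_mul_add_self (x : M) : 0 * x + x = x := by
  calc 0 * x + x = x * 0 + x * 1 := by
        rw [CommonMeadow.mul_comm 0 x, CommonMeadow.mul_comm x 1, CommonMeadow.one_mul]
    _ = x * (1 + 0) := by rw [← CommonMeadow.mul_add, CommonMeadow.add_comm 0 1]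
    _ = x := by rw [CommonMeadow.add_zero, CommonMeadow.mul_comm, CommonMeadow.one_mul]

theorem add_neg_add_self (x : M) : x + (-x) + x = x := by
  rw [CommonMeadow.add_neg, zero_mul_add_self]

theorem neg_add_self_add_neg (x : M) : -x + x + -x = -x := by
  simpa only [CommonMeadow.neg_neg] using add_neg_add_self (-x)

end CommonMeadow

/-- Weak inverses in a commutative additive semigroup are unique. -/
theorem weak_neg_unique {S : Type*} [AddCommSemigroup S] {x y z : S}
    (hxy : x + y + x = x) (hyx : y + x + y = y)
    (hxz : x + z + x = x) (hzx : z + x + z = z) : y = z := by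
  calc y = y + (x + z + x) + y := by rw [hxz, hyx]
    _ = (y + x + y) + x + z := by ac_rfl
    _ = (z + x + z) + x + y := by rw [hyx, hzx]; ac_rfl
    _ = z + (x + y + x) + z := by ac_rfl
    _ = z := by rw [hxy, hzx]

theorem stmt17 {M : Type*} [CommonMeadow M] :
    (∀ x : M, x + (-x) + x = x) ∧
    (∀ x y : M, x + y + x = x → y + x + y = y → y = -x) := by
  exact ⟨CommonMeadow.add_neg_add_self, fun x _ hxy hyx =>
    weak_neg_unique hxy hyx (CommonMeadow.add_neg_add_self x)
      (CommonMeadow.neg_add_self_add_neg x)⟩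
end

section
/- The commutative ring ℤ[X]/(X²) (the polynomial ring over ℤ in one indeterminate X modulo the ideal generated by X², i.e., the dual numbers over ℤ) is not reduced, yet it satisfies: for all x, y, z, if x·(y·y + z·z + 1) = 0 then x = 0. -/
/-- The ring ℤ[X]/(X²), the dual numbers over ℤ, is not reduced
(in the sense that x·x = 0 need not imply x = 0), yet multiplication by a
sum of two squares plus one is injective at zero. -/
theorem stmt18 :
    ¬ (∀ x : DualNumber ℤ, x * x = 0 → x = 0) ∧
    (∀ x y z : DualNumber ℤ, x * (y * y + z * z + 1) = 0 → x = 0) := by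
  refine ⟨fun h => ?_, fun x y z h => ?_⟩
  · have h1 := congrArg TrivSqZeroExt.snd (h DualNumber.eps DualNumber.eps_mul_eps)
    simp at h1
  · have hpos : y.fst * y.fst + z.fst * z.fst + 1 ≠ 0 := by
      have := add_nonneg (mul_self_nonneg y.fst) (mul_self_nonneg z.fst)
      omega
    have h1 : x.fst = 0 := by
      have h2 := congrArg TrivSqZeroExt.fst h
      simp only [TrivSqZeroExt.fst_mul, TrivSqZeroExt.fst_add, TrivSqZeroExt.fst_one,
        TrivSqZeroExt.fst_zero] at h2
      exact (mul_eq_zero.mp h2).resolve_right hpos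
    have h3 : x.snd = 0 := by
      have h2 := congrArg TrivSqZeroExt.snd h
      rw [DualNumber.snd_mul, h1, zero_mul, zero_add] at h2
      simp only [TrivSqZeroExt.fst_mul, TrivSqZeroExt.fst_add, TrivSqZeroExt.fst_one,
        TrivSqZeroExt.snd_zero] at h2
      exact (mul_eq_zero.mp h2).resolve_right hpos
    exact TrivSqZeroExt.ext h1 h3
end
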